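/- arXiv:2109.08215 — 3 statements merged into one kernel-verified Lean document; each statement's English description precedes it below -/
import Mathlib

section
/- Let d, M, N be positive integers, let x_1, …, x_M be pairwise distinct points in ℝ^d, let μ ∈ ℝ^M be a vector, let V be a real N×M matrix and set K = Vᵀ V. Then there exist functions μ̂ : ℝ^d → ℝ and k̂ : ℝ^d × ℝ^d → ℝ such that (i) k̂ is a positive-semidefinite kernel, i.e. k̂(x, x') = k̂(x', x) for all x, x' and for every n ∈ ℕ, every tuple of points z_1, …, z_n ∈ ℝ^d and every c ∈ ℝ^n one has ∑_{a=1}^n ∑_{b=1}^n c_a c_b k̂(z_a, z_b) ≥ 0, (ii) μ̂(x_i) = μ_i for all i ∈ {1,…,M}, and (iii) k̂(x_i, x_j) = K_{ij} for all i, j ∈ {1,…,M}. (This is the content of Proposition 1: a Gaussian process GP(μ̂, k̂) exists whose mean vector and covariance matrix on the inputs x_1,…,x_M coincide exactly with μ and K, so the KL divergence between N(μ, K) and N(μ̂(x), k̂(x)) is zero.) -/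
open Matrix Finset

/-- Proposition 1: there exists a GP mean function and PSD kernel matching a given
mean vector and Gram matrix `K = Vᵀ V` on the distinct inputs `x 1, …, x M`. -/
theorem gp_exists_matching_mean_cov
    (d M N : ℕ) (hd : 0 < d) (hM : 0 < M) (hN : 0 < N)
    (x : Fin M → (Fin d → ℝ)) (hx : Function.Injective x)
    (μ : Fin M → ℝ) (V : Matrix (Fin N) (Fin M) ℝ)
    (K : Matrix (Fin M) (Fin M) ℝ) (hK : K = Vᵀ * V) :
    ∃ (μhat : (Fin d → ℝ) → ℝ) (khat : (Fin d → ℝ) → (Fin d → ℝ) → ℝ),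
      (∀ x₁ x₂ : Fin d → ℝ, khat x₁ x₂ = khat x₂ x₁) ∧
      (∀ (n : ℕ) (z : Fin n → (Fin d → ℝ)) (c : Fin n → ℝ),
        0 ≤ ∑ a, ∑ b, c a * c b * khat (z a) (z b)) ∧
      (∀ i : Fin M, μhat (x i) = μ i) ∧
      (∀ i j : Fin M, khat (x i) (x j) = K i j) := by
  refine ⟨Function.extend x μ 0,
    fun y₁ y₂ => ∑ l, Function.extend x (fun i => V l i) 0 y₁ *
      Function.extend x (fun i => V l i) 0 y₂, ?_, ?_, ?_, ?_⟩
  · intro y₁ y₂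
    exact Finset.sum_congr rfl fun l _ => mul_comm _ _
  · intro n z c
    have h : ∑ a, ∑ b, c a * c b * (∑ l, Function.extend x (fun i => V l i) 0 (z a) *
        Function.extend x (fun i => V l i) 0 (z b)) =
        ∑ l, (∑ a, c a * Function.extend x (fun i => V l i) 0 (z a)) ^ 2 := by
      simp_rw [sq, Finset.sum_mul_sum, Finset.mul_sum]
      symm
      rw [Finset.sum_comm]
      refine Finset.sum_congr rfl fun a _ => ?_
      rw [Finset.sum_comm]
      exact Finset.sum_congr rfl fun b _ => Finset.sum_congr rfl fun l _ => by ring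
    beta_reduce
    rw [h]
    exact Finset.sum_nonneg fun l _ => sq_nonneg _
  · intro i
    exact hx.extend_apply _ _ i
  · intro i j
    simp [hK, Matrix.mul_apply, hx.extend_apply]
end

section
/- Let M ≥ R ≥ 1 be integers, let A be a real M×R matrix of rank R (so Aᵀ A is invertible), set K̃ = A Aᵀ and let K̃⁺ = A (AᵀA)^{−1} (AᵀA)^{−1} Aᵀ (the Moore–Penrose pseudoinverse of K̃). Let μ̃, μ ∈ ℝ^M and let K be a real symmetric positive-definite M×M matrix. Define ℓ_p(x) = −½ ln((2π)^R det(AᵀA)) − ½ (x−μ̃)ᵀ K̃⁺ (x−μ̃) (the log-density of the degenerate Gaussian N(μ̃, K̃) with pseudo-determinant det(AᵀA)) and ℓ_q(x) = −½ ln((2π)^M det K) − ½ (x−μ)ᵀ K^{−1} (x−μ). Let z be a standard Gaussian random vector in ℝ^R, i.e. z is distributed according to the product over R coordinates of the real Gaussian measure with mean 0 and variance 1. Then E_z[ ℓ_p(μ̃ + A z) − ℓ_q(μ̃ + A z) ] = ½ ( tr(K^{−1} K̃) + (μ − μ̃)ᵀ K^{−1} (μ − μ̃) + ln det K − ln det(AᵀA)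 − R + (M − R) ln(2π) ). (This is the closed form of the pseudo KL divergence D*_KL(N(μ̃, K̃), N(μ, K)) for the degenerate Gaussian supported on the affine subspace {μ̃ + A v : v ∈ ℝ^R}.) -/
open Matrix MeasureTheory ProbabilityTheory Real

lemma mom (R : ℕ) (i j : Fin R) :
    Integrable (fun z : Fin R → ℝ => z i * z j) (Measure.pi fun _ : Fin R => gaussianReal 0 1) ∧
    ∫ z : Fin R → ℝ, z i * z j ∂(Measure.pi fun _ : Fin R => gaussianReal 0 1) =
      if i = j then 1 else 0 := by
  have hm : ∀ i : Fin R, MemLp (fun z : Fin R → ℝ => z i) 2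
      (Measure.pi fun _ : Fin R => gaussianReal 0 1) := fun i =>
    (memLp_id_gaussianReal' (μ := 0) (v := 1) 2 (by simp)).comp_measurePreserving
      (measurePreserving_eval (fun _ : Fin R => gaussianReal 0 1) i)
  have h1 : ∀ i : Fin R, ∫ z : Fin R → ℝ, z i ∂(Measure.pi fun _ : Fin R => gaussianReal 0 1) = 0 := by
    intro i
    have := integral_comp_eval (μ := fun _ : Fin R => gaussianReal 0 1) (i := i)
      (f := fun x : ℝ => x) (by fun_prop)
    rw [this, integral_id_gaussianReal]
  refine ⟨(hm i).integrable_mul (hm j), ?_⟩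
  split_ifs with h
  · subst h
    have h2 := integral_comp_eval (μ := fun _ : Fin R => gaussianReal 0 1) (i := i)
      (f := fun x : ℝ => x * x) (by fun_prop)
    rw [h2]
    have hv := variance_id_gaussianReal (μ := 0) (v := 1)
    rw [variance_of_integral_eq_zero (by fun_prop) (by simp)] at hv
    simpa [sq] using hv
  · have hind := iIndepFun_pi (μ := fun _ : Fin R => gaussianReal 0 1)
      (X := fun _ : Fin R => (id : ℝ → ℝ)) (fun _ => by fun_prop)
    have := (hind.indepFun h).integral_mul_eq_mul_integral
      (hm i).aestronglyMeasurable (hm j).aestronglyMeasurable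
    simpa [h1] using this

lemma lin (R : ℕ) (w : Fin R → ℝ) :
    Integrable (fun z : Fin R → ℝ => w ⬝ᵥ z) (Measure.pi fun _ : Fin R => gaussianReal 0 1) ∧
    ∫ z : Fin R → ℝ, w ⬝ᵥ z ∂(Measure.pi fun _ : Fin R => gaussianReal 0 1) = 0 := by
  have hm : ∀ i : Fin R, Integrable (fun z : Fin R → ℝ => z i)
      (Measure.pi fun _ : Fin R => gaussianReal 0 1) := fun i =>
    ((memLp_id_gaussianReal' (μ := 0) (v := 1) 1 (by simp)).comp_measurePreserving
      (measurePreserving_eval (fun _ : Fin R => gaussianReal 0 1) i)).integrable le_rfl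
  have h1 : ∀ i : Fin R, ∫ z : Fin R → ℝ, z i ∂(Measure.pi fun _ : Fin R => gaussianReal 0 1) = 0 := by
    intro i
    have := integral_comp_eval (μ := fun _ : Fin R => gaussianReal 0 1) (i := i)
      (f := fun x : ℝ => x) (by fun_prop)
    rw [this, integral_id_gaussianReal]
  simp only [dotProduct]
  refine ⟨integrable_finsetSum _ fun i _ => (hm i).const_mul _, ?_⟩
  rw [integral_finsetSum _ fun i _ => (hm i).const_mul _]
  simp [integral_const_mul, h1]

lemma quad (R : ℕ) (B : Matrix (Fin R) (Fin R) ℝ) :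
    Integrable (fun z : Fin R → ℝ => z ⬝ᵥ B *ᵥ z) (Measure.pi fun _ : Fin R => gaussianReal 0 1) ∧
    ∫ z : Fin R → ℝ, z ⬝ᵥ B *ᵥ z ∂(Measure.pi fun _ : Fin R => gaussianReal 0 1) = B.trace := by
  have e : ∀ z : Fin R → ℝ, z ⬝ᵥ B *ᵥ z = ∑ i, ∑ j, B i j * (z i * z j) := by
    intro z
    simp only [dotProduct, mulVec, Finset.mul_sum]
    exact Finset.sum_congr rfl fun i _ => Finset.sum_congr rfl fun j _ => by ring
  simp only [e]
  have hI : ∀ i j : Fin R, Integrable (fun z : Fin R → ℝ => B i j * (z i * z j))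
    (Measure.pi fun _ : Fin R => gaussianReal 0 1) := fun i j => (mom R i j).1.const_mul _
  have hI2 := fun i : Fin R => integrable_finsetSum Finset.univ fun j _ => hI i j
  refine ⟨integrable_finsetSum _ fun i _ => hI2 i, ?_⟩
  rw [integral_finsetSum _ fun i _ => hI2 i]
  simp only [Matrix.trace, Matrix.diag]
  refine Finset.sum_congr rfl fun i _ => ?_
  rw [integral_finsetSum _ fun j _ => hI i j]
  simp [integral_const_mul, (mom R _ _).2]

/-- Closed form of the pseudo KL divergence between the degenerate Gaussian
`N(μ̃, AAᵀ)` (supported on `{μ̃ + A v}`) and the nondegenerate Gaussian `N(μ, K)`. -/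
theorem pseudo_kl_closed_form
    (M R : ℕ) (hR : 1 ≤ R) (hMR : R ≤ M)
    (A : Matrix (Fin M) (Fin R) ℝ) (hA : A.rank = R)
    (μt μ : Fin M → ℝ) (K : Matrix (Fin M) (Fin M) ℝ) (hK : K.PosDef)
    (Kt Ktp : Matrix (Fin M) (Fin M) ℝ)
    (hKt : Kt = A * Aᵀ)
    (hKtp : Ktp = A * (Aᵀ * A)⁻¹ * (Aᵀ * A)⁻¹ * Aᵀ)
    (ℓp ℓq : (Fin M → ℝ) → ℝ)
    (hℓp : ∀ x : Fin M → ℝ, ℓp x =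
      -(1/2) * Real.log ((2 * π) ^ R * (Aᵀ * A).det)
        - (1/2) * ((x - μt) ⬝ᵥ Ktp.mulVec (x - μt)))
    (hℓq : ∀ x : Fin M → ℝ, ℓq x =
      -(1/2) * Real.log ((2 * π) ^ M * K.det)
        - (1/2) * ((x - μ) ⬝ᵥ K⁻¹.mulVec (x - μ))) :
    ∫ z : Fin R → ℝ, (ℓp (μt + A.mulVec z) - ℓq (μt + A.mulVec z))
        ∂(Measure.pi fun _ : Fin R => gaussianReal 0 1) =
      (1/2) * ((K⁻¹ * Kt).trace + (μ - μt) ⬝ᵥ K⁻¹.mulVec (μ - μt)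
        + Real.log K.det - Real.log (Aᵀ * A).det - R
        + ((M : ℝ) - R) * Real.log (2 * π)) := by
  have hrk : (Aᵀ * A).rank = Fintype.card (Fin R) := by
    rw [rank_transpose_mul_self, hA, Fintype.card_fin]
  have hU : IsUnit (Aᵀ * A) := by
    rw [← mulVec_surjective_iff_isUnit]
    have : LinearMap.range (Aᵀ * A).mulVecLin = ⊤ := by
      apply Submodule.eq_top_of_finrank_eq
      rw [Module.finrank_fintype_fun_eq_card]
      exact hrk
    exact LinearMap.range_eq_top.1 this
  have hD : IsUnit (Aᵀ * A).det := (Matrix.isUnit_iff_isUnit_det _).1 hU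
  have hKd : K.det ≠ 0 := hK.det_pos.ne'
  have h2 : (2 * π : ℝ) ≠ 0 := by positivity
  have hmid : Aᵀ * Ktp * A = 1 := by
    rw [hKtp]
    calc _ = (Aᵀ * A) * (Aᵀ * A)⁻¹ * ((Aᵀ * A)⁻¹ * (Aᵀ * A)) := by simp only [Matrix.mul_assoc]
      _ = 1 := by rw [Matrix.mul_nonsing_inv _ hD, Matrix.nonsing_inv_mul _ hD, one_mul]
  have key : ∀ (P : Matrix (Fin M) (Fin M) ℝ) (z : Fin R → ℝ),
      (A *ᵥ z) ⬝ᵥ P *ᵥ (A *ᵥ z) = z ⬝ᵥ (Aᵀ * P * A) *ᵥ z := by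
    intro P z
    rw [← mulVec_mulVec, ← mulVec_mulVec, dotProduct_mulVec z, vecMul_transpose]
  set c : ℝ := -(1/2) * Real.log ((2 * π) ^ R * (Aᵀ * A).det) +
    (1/2) * Real.log ((2 * π) ^ M * K.det) + (1/2) * ((μt - μ) ⬝ᵥ K⁻¹ *ᵥ (μt - μ)) with hc
  set w : Fin R → ℝ := ((μt - μ) ᵥ* K⁻¹) ᵥ* A + Aᵀ *ᵥ (K⁻¹ *ᵥ (μt - μ)) with hw
  have hpt : ∀ z : Fin R → ℝ, ℓp (μt + A.mulVec z) - ℓq (μt + A.mulVec z) =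
      c + (1/2) * (w ⬝ᵥ z) + (1/2) * (z ⬝ᵥ (Aᵀ * K⁻¹ * A - 1) *ᵥ z) := by
    intro z
    have e1 : μt + A *ᵥ z - μt = A *ᵥ z := by abel
    have e2 : μt + A *ᵥ z - μ = (μt - μ) + A *ᵥ z := by abel
    have e3 : w ⬝ᵥ z = (μt - μ) ⬝ᵥ K⁻¹ *ᵥ (A *ᵥ z) + (A *ᵥ z) ⬝ᵥ K⁻¹ *ᵥ (μt - μ) := by
      rw [hw, add_dotProduct, ← dotProduct_mulVec, ← dotProduct_mulVec, mulVec_transpose,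
        ← dotProduct_mulVec, dotProduct_comm (K⁻¹ *ᵥ (μt - μ))]
    rw [hℓp, hℓq, e1, e2, key, hmid, e3, sub_mulVec, dotProduct_sub, ← key, mulVec_add,
      dotProduct_add, add_dotProduct, add_dotProduct, hc]
    ring
  simp only [hpt]
  have I1 : Integrable (fun z : Fin R → ℝ => (1/2) * (w ⬝ᵥ z))
    (Measure.pi fun _ : Fin R => gaussianReal 0 1) := (lin R w).1.const_mul _
  have I2 : Integrable (fun z : Fin R → ℝ => (1/2) * (z ⬝ᵥ (Aᵀ * K⁻¹ * A - 1) *ᵥ z))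
    (Measure.pi fun _ : Fin R => gaussianReal 0 1) := (quad R _).1.const_mul _
  have I0 : Integrable (fun z : Fin R → ℝ => c + (1/2) * (w ⬝ᵥ z))
    (Measure.pi fun _ : Fin R => gaussianReal 0 1) := (integrable_const c).add I1
  rw [integral_add I0 I2, integral_add (integrable_const c) I1,
    integral_const_mul, integral_const_mul, (lin R w).2, (quad R _).2]
  have e4 : (μt - μ) ⬝ᵥ K⁻¹ *ᵥ (μt - μ) = (μ - μt) ⬝ᵥ K⁻¹ *ᵥ (μ - μt) := by
    rw [← neg_sub μ μt, mulVec_neg, neg_dotProduct_neg]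
  have e5 : (Aᵀ * K⁻¹ * A).trace = (K⁻¹ * Kt).trace := by
    rw [hKt, Matrix.mul_assoc, Matrix.trace_mul_comm, Matrix.mul_assoc]
  rw [trace_sub, e5, trace_one, hc, e4, Real.log_mul (pow_ne_zero _ h2) hD.ne_zero,
    Real.log_mul (pow_ne_zero _ h2) hKd, Real.log_pow, Real.log_pow]
  simp
  ring
end

section
/- There exist integers M > R ≥ 1, a real M×R matrix A of rank R, vectors μ̃, μ ∈ ℝ^M, and a real symmetric positive-definite M×M matrix K such that the pseudo KL divergence ½ ( tr(K^{−1} A Aᵀ) + (μ − μ̃)ᵀ K^{−1} (μ − μ̃) + ln det K − ln det(AᵀA) − R + (M − R) ln(2π) ) is strictly negative. (This witnesses the paper's claim that, unlike the KL divergence between nondegenerate Gaussians, the pseudo KL divergence D*_KL for a degenerate first argument does not satisfy nonnegativity.) -/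
open Matrix Real

/-- The pseudo KL divergence between a degenerate Gaussian `N(μ̃, AAᵀ)` of rank `R < M`
and a nondegenerate Gaussian `N(μ, K)` can be strictly negative. -/
theorem pseudo_kl_can_be_negative :
    ∃ (M R : ℕ), 1 ≤ R ∧ R < M ∧
      ∃ (A : Matrix (Fin M) (Fin R) ℝ) (μt μ : Fin M → ℝ)
        (K : Matrix (Fin M) (Fin M) ℝ),
        A.rank = R ∧ K.PosDef ∧
        (1/2) * ((K⁻¹ * (A * Aᵀ)).trace + (μ - μt) ⬝ᵥ K⁻¹.mulVec (μ - μt)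
          + Real.log K.det - Real.log (Aᵀ * A).det - R
          + ((M : ℝ) - R) * Real.log (2 * π)) < 0 := by
  have hinv : (Matrix.diagonal ![(1:ℝ), 1/8])⁻¹ = Matrix.diagonal ![(1:ℝ), 8] := by
    apply Matrix.inv_eq_right_inv
    ext i j
    fin_cases i <;> fin_cases j <;> simp [Matrix.mul_apply, Fin.sum_univ_two]
  have hAA : ((!![1; 0] : Matrix (Fin 2) (Fin 1) ℝ)ᵀ * (!![1; 0] : Matrix (Fin 2) (Fin 1) ℝ)) = 1 := by
    ext i j
    fin_cases i; fin_cases j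
    simp [Matrix.mul_apply, Fin.sum_univ_two]
  refine ⟨2, 1, le_refl _, by norm_num, !![1; 0], 0, 0, Matrix.diagonal ![1, 1/8], ?_, ?_, ?_⟩
  · rw [← Matrix.rank_transpose_mul_self, hAA, Matrix.rank_one]
    simp
  · apply Matrix.PosDef.diagonal
    intro i
    fin_cases i <;> simp
  · rw [hinv, hAA]
    have htr : (Matrix.diagonal ![(1:ℝ), 8] *
        ((!![1; 0] : Matrix (Fin 2) (Fin 1) ℝ) * (!![1; 0] : Matrix (Fin 2) (Fin 1) ℝ)ᵀ)).trace
        = 1 := by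
      simp [Matrix.trace, Matrix.mul_apply, Fin.sum_univ_two, Matrix.vecMul, dotProduct]
    have hdet : (Matrix.diagonal ![(1:ℝ), 1/8]).det = 1/8 := by
      simp [Matrix.det_diagonal, Fin.prod_univ_two]
    have hlog : Real.log (1/8) + Real.log (2 * π) < 0 := by
      rw [← Real.log_mul (by norm_num) (by positivity)]
      apply Real.log_neg (by positivity)
      linarith [Real.pi_lt_four]
    rw [htr, hdet]
    simp only [sub_zero, zero_dotProduct, Matrix.det_one, Real.log_one]
    push_cast
    linarith
end
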